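/- arXiv:2001.07177 — 3 statements merged into one kernel-verified Lean document; each statement's English description precedes it below -/
import Mathlib

section
/- Assume ρ > 0 and that B'(t)/B(t) = Σ_{j=0}^∞ 2 b_j e^{−jt} for t > 0, with the series converging absolutely, so that ρ = α + β + 1 + b_0. Then there exist functions Γ_n (n ≥ 0), each holomorphic on 𝒟 = ℂ ∖ {−im/2 : m ∈ ℕ, m ≥ 1}, with Γ_0 ≡ 1, such that for every λ ∈ 𝒟: (i) for every t_0 > 0 the series Φ_λ(t) = e^{(iλ−ρ)t} Σ_{n=0}^∞ Γ_n(λ) e^{−nt} converges absolutely and uniformly for t ≥ t_0; (ii) t ↦ Φ_λ(t) is a solution of u''(t) + (A'(t)/A(t)) u'(t) + (λ² + ρ²) u(t) = 0 on (0,∞); (iii) for each fixed t > 0, the maps λ ↦ Φ_λ(t) and λ ↦ Φ_λ'(t) are holomorphic on 𝒟. -/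
open Complex Real Set Filter MeasureTheory Topology

noncomputable def hcG (a : ℕ → ℂ) (ρ : ℂ) : ℕ → ℂ → ℂ
  | 0, _ => 1
  | (n+1), l => -(∑ k : Fin (n+1), a (n+1-k) * ((I*l-ρ) - (k:ℕ)) * hcG a ρ k l) /
      (((n+1:ℕ):ℂ) * (((n+1:ℕ):ℂ) - 2*I*l))
termination_by n => n
decreasing_by exact k.2

lemma hcG_zero (a : ℕ → ℂ) (ρ l : ℂ) : hcG a ρ 0 l = 1 := by
  rw [hcG]

lemma hcG_succ (a : ℕ → ℂ) (ρ l : ℂ) (n : ℕ) : hcG a ρ (n+1) l =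
   -(∑ k ∈ Finset.range (n+1), a (n+1-k) * ((I*l-ρ) - (k:ℕ)) * hcG a ρ k l) /
      (((n+1:ℕ):ℂ) * (((n+1:ℕ):ℂ) - 2*I*l)) := by
  rw [hcG, Finset.sum_range]

lemma hc_den {l : ℂ} (hl : ∀ m : ℕ, 1 ≤ m → l ≠ -(I * m) / 2) (n : ℕ) (hn : 1 ≤ n) :
    (n:ℂ) - 2*I*l ≠ 0 := by
  intro h
  apply hl n hn
  linear_combination (I/2) * h + l * I_sq

lemma hcG_rec (a : ℕ → ℂ) (ρ : ℂ) {l : ℂ} (hl : ∀ m : ℕ, 1 ≤ m → l ≠ -(I * m) / 2) (n : ℕ) :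
    (n:ℂ) * ((n:ℂ) - 2*I*l) * hcG a ρ n l =
      -(∑ k ∈ Finset.range n, a (n-k) * ((I*l-ρ) - (k:ℕ)) * hcG a ρ k l) := by
  cases n with
  | zero => simp
  | succ n =>
    rw [hcG_succ a ρ l n]
    have h1 : ((n+1:ℕ):ℂ) ≠ 0 := by exact_mod_cast Nat.succ_ne_zero n
    have h2 := hc_den hl (n+1) (by omega)
    field_simp

lemma hcG_diff (a : ℕ → ℂ) (ρ : ℂ) (n : ℕ) :
    DifferentiableOn ℂ (hcG a ρ n) {l : ℂ | ∀ m : ℕ, 1 ≤ m → l ≠ -(I * m) / 2} := by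
  induction n using Nat.strong_induction_on with
  | _ n ih =>
    cases n with
    | zero =>
      have : hcG a ρ 0 = fun _ => 1 := by funext l; exact hcG_zero a ρ l
      rw [this]; exact differentiableOn_const _
    | succ n =>
      rw [show hcG a ρ (n+1) = _ from funext (fun l => hcG_succ a ρ l n)]
      apply DifferentiableOn.div
      · apply DifferentiableOn.neg
        apply DifferentiableOn.fun_sum
        intro k hk
        apply DifferentiableOn.mul
        · fun_prop
        · exact ih k (by simpa using hk)
      · fun_prop
      · intro l hl
        exact mul_ne_zero (by exact_mod_cast Nat.succ_ne_zero n) (hc_den hl (n+1) (by omega))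

lemma hc_lower {l : ℂ} (hl : ∀ m : ℕ, 1 ≤ m → l ≠ -(I * m) / 2) :
    ∃ d : ℝ, 0 < d ∧ ∀ n : ℕ, 1 ≤ n → d * n ≤ ‖(n:ℂ) - 2*I*l‖ := by
  have key : ∀ N : ℕ, ∃ d : ℝ, 0 < d ∧ ∀ n : ℕ, 1 ≤ n → n ≤ N → d * n ≤ ‖(n:ℂ) - 2*I*l‖ := by
    intro N
    induction N with
    | zero => exact ⟨1, one_pos, fun n h1 h2 => by omega⟩
    | succ N ih =>
      obtain ⟨d, hd, h⟩ := ih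
      have hp : 0 < ‖((N+1:ℕ):ℂ) - 2*I*l‖ := norm_pos_iff.2 (hc_den hl (N+1) (by omega))
      have hN : (0:ℝ) < ((N+1:ℕ):ℝ) := by positivity
      refine ⟨min d (‖((N+1:ℕ):ℂ) - 2*I*l‖ / ((N+1:ℕ):ℝ)), lt_min hd (by positivity), ?_⟩
      intro n h1 h2
      rcases Nat.lt_or_ge N n with h3 | h3
      · have : n = N+1 := by omega
        subst this
        rw [← le_div_iff₀ hN]
        exact min_le_right _ _
      · refine le_trans ?_ (h n h1 h3)
        gcongr
        exact min_le_left _ _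
  obtain ⟨N, hN⟩ := exists_nat_ge (4*‖l‖)
  obtain ⟨d, hd, h⟩ := key N
  refine ⟨min d (1/2), lt_min hd (by norm_num), fun n h1 => ?_⟩
  rcases Nat.lt_or_ge N n with h3 | h3
  · have h4 : ‖(n:ℂ)‖ - ‖2*I*l‖ ≤ ‖(n:ℂ) - 2*I*l‖ := norm_sub_norm_le _ _
    have h5 : ‖2*I*l‖ = 2*‖l‖ := by simp
    have h6 : ‖(n:ℂ)‖ = n := by simp
    have h7 : (N:ℝ) < n := by exact_mod_cast h3
    have h8 : min d (1/2) * (n:ℝ) ≤ (1/2) * n := by gcongr; exact min_le_right _ _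
    rw [h5, h6] at h4
    linarith
  · refine le_trans ?_ (h n h1 h3)
    gcongr
    exact min_le_left _ _

/-- local uniform bound -/
lemma hcG_bound (a : ℕ → ℂ) (ρ : ℂ)
    (ha : ∀ t : ℝ, 0 < t → Summable (fun j : ℕ => ‖a j‖ * Real.exp (-(j : ℝ) * t)))
    {l₀ : ℂ} (hl₀ : ∀ m : ℕ, 1 ≤ m → l₀ ≠ -(I * m) / 2) :
    ∃ r : ℝ, 0 < r ∧ (∀ l ∈ Metric.ball l₀ r, ∀ m : ℕ, 1 ≤ m → l ≠ -(I * m) / 2) ∧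
      ∀ s : ℝ, 0 < s → ∃ D : ℝ, 0 < D ∧ ∀ l ∈ Metric.ball l₀ r, ∀ n : ℕ,
        ‖hcG a ρ n l‖ ≤ D * Real.exp (n * s) := by
  obtain ⟨d, hd, hdl⟩ := hc_lower hl₀
  have hlow : ∀ l ∈ Metric.ball l₀ (d/4), ∀ n : ℕ, 1 ≤ n → d/2 * n ≤ ‖(n:ℂ) - 2*I*l‖ := by
    intro l hl n hn
    have h1 := hdl n hn
    have h2 : ‖(n:ℂ) - 2*I*l₀‖ - ‖2*I*(l-l₀)‖ ≤ ‖(n:ℂ) - 2*I*l‖ := by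
      have := norm_sub_norm_le ((n:ℂ) - 2*I*l₀) (2*I*(l-l₀))
      rwa [show (n:ℂ) - 2*I*l₀ - 2*I*(l-l₀) = (n:ℂ) - 2*I*l by ring] at this
    have h3 : ‖2*I*(l-l₀)‖ = 2*‖l-l₀‖ := by simp
    have h4 : ‖l-l₀‖ < d/4 := by simpa [dist_eq_norm] using hl
    have h5 : (1:ℝ) ≤ n := by exact_mod_cast hn
    nlinarith
  have hmem : ∀ l ∈ Metric.ball l₀ (d/4), ∀ m : ℕ, 1 ≤ m → l ≠ -(I * m) / 2 := by
    intro l hl m hm h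
    have h1 := hlow l hl m hm
    have h2 : (m:ℂ) - 2*I*l = 0 := by
      rw [h]; linear_combination (m:ℂ) * I_sq
    rw [h2, norm_zero] at h1
    have h5 : (1:ℝ) ≤ m := by exact_mod_cast hm
    nlinarith
  refine ⟨d/4, by positivity, hmem, ?_⟩
  intro s hs
  set M := ∑' j : ℕ, ‖a j‖ * Real.exp (-(j : ℝ) * s) with hM
  have hM0 : 0 ≤ M := tsum_nonneg (fun j => by positivity)
  set C := ‖l₀‖ + d/4 + ‖ρ‖ + 1 with hC
  have hC0 : 0 < C := by positivity
  set Q := C * M / (d/2) with hQ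
  have hQ0 : 0 ≤ Q := by positivity
  obtain ⟨N, hN⟩ := exists_nat_ge Q
  set L := max 1 Q with hL
  have hL1 : 1 ≤ L := le_max_left _ _
  refine ⟨L^N, by positivity, ?_⟩
  intro l hl
  have claim : ∀ n : ℕ, ‖hcG a ρ n l‖ ≤ L^(min n N) * Real.exp (n * s) := by
    intro n
    induction n using Nat.strong_induction_on with
    | _ n ih =>
      cases n with
      | zero => simp [hcG_zero]
      | succ n =>
        have hrec := hcG_rec a ρ (hmem l hl) (n+1)
        have hnorm := congrArg norm hrec
        rw [norm_neg, norm_mul, norm_mul, Complex.norm_natCast] at hnorm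
        have hlw := hlow l hl (n+1) (by omega)
        have hn0 : (0:ℝ) < ((n+1:ℕ):ℝ) := by positivity
        have hterm : ∀ k ∈ Finset.range (n+1),
            ‖a (n+1-k) * ((I*l-ρ) - (k:ℕ)) * hcG a ρ k l‖ ≤
            (C * ((n+1:ℕ):ℝ) * (L^(min n N)) * Real.exp (((n+1:ℕ):ℝ)*s)) *
              (‖a (n+1-k)‖ * Real.exp (-((n+1-k:ℕ):ℝ) * s)) := by
          intro k hk
          have hk' : k < n+1 := by simpa using hk
          have hk1 : (k:ℝ) + 1 ≤ ((n+1:ℕ):ℝ) := by exact_mod_cast hk'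
          rw [norm_mul, norm_mul]
          have e1 : ‖(I*l-ρ) - (k:ℂ)‖ ≤ C * ((n+1:ℕ):ℝ) := by
            have h4 : ‖l-l₀‖ < d/4 := by simpa [dist_eq_norm] using hl
            have h5 : ‖l‖ ≤ ‖l₀‖ + ‖l-l₀‖ := by
              have := norm_add_le l₀ (l-l₀); simpa using this
            have h6 : ‖(I*l-ρ) - (k:ℂ)‖ ≤ ‖l‖ + ‖ρ‖ + k := by
              refine (norm_sub_le _ _).trans ?_
              have := norm_sub_le (I*l) ρ
              simp at this ⊢
              linarith
            have h7 : (0:ℝ) ≤ k := by positivity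
            have h8 : 0 ≤ ‖l₀‖ := norm_nonneg _
            have h9 : 0 ≤ ‖ρ‖ := norm_nonneg _
            have : ‖l‖ + ‖ρ‖ + k ≤ C * (k+1) := by
              rw [hC]; nlinarith
            have : C * ((k:ℝ)+1) ≤ C * ((n+1:ℕ):ℝ) := by gcongr
            linarith
          have e2 : ‖hcG a ρ k l‖ ≤ L^(min n N) * (Real.exp (((n+1:ℕ):ℝ)*s) * Real.exp (-((n+1-k:ℕ):ℝ) * s)) := by
            refine (ih k hk').trans ?_
            rw [← Real.exp_add]
            have : ((n+1:ℕ):ℝ)*s + (-((n+1-k:ℕ):ℝ) * s) = k*s := by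
              rw [Nat.cast_sub hk'.le]; ring
            rw [this]
            gcongr
            omega
          calc _ ≤ ‖a (n+1-k)‖ * (C * ((n+1:ℕ):ℝ)) * (L^(min n N) * (Real.exp (((n+1:ℕ):ℝ)*s) * Real.exp (-((n+1-k:ℕ):ℝ) * s))) := by gcongr
            _ = _ := by ring
        have hsum : ‖∑ k ∈ Finset.range (n+1), a (n+1-k) * ((I*l-ρ) - (k:ℕ)) * hcG a ρ k l‖ ≤
            (C * ((n+1:ℕ):ℝ) * (L^(min n N)) * Real.exp (((n+1:ℕ):ℝ)*s)) * M := by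
          refine (norm_sum_le_of_le _ hterm).trans ?_
          rw [← Finset.mul_sum]
          gcongr
          have : ∑ k ∈ Finset.range (n+1), (‖a (n+1-k)‖ * Real.exp (-((n+1-k:ℕ):ℝ) * s)) =
              ∑ k ∈ Finset.range (n+1), (‖a (k+1)‖ * Real.exp (-((k+1:ℕ):ℝ) * s)) := by
            rw [← Finset.sum_range_reflect]
            apply Finset.sum_congr rfl
            intro k hk
            have hk' : k < n+1 := by simpa using hk
            rw [show n+1-(n+1-1-k) = k+1 by omega]
          rw [this]
          have h2 := (ha s hs).sum_le_tsum (Finset.range (n+2)) (fun j _ => by positivity)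
          rw [Finset.sum_range_succ'] at h2
          have : 0 ≤ ‖a 0‖ * Real.exp (-((0:ℕ):ℝ) * s) := by positivity
          linarith
        rw [← hnorm] at hsum
        set g := ‖hcG a ρ (n+1) l‖
        set E := Real.exp (((n+1:ℕ):ℝ)*s)
        have h1 : ((n+1:ℕ):ℝ) * (d/2 * ((n+1:ℕ):ℝ)) * g ≤ C * ((n+1:ℕ):ℝ) * (L^(min n N)) * E * M :=
          le_trans (by gcongr) hsum
        have h2 : ((n+1:ℕ):ℝ) * g ≤ Q * (L^(min n N) * E) := by
          have : (((n+1:ℕ):ℝ) * (d/2)) * (((n+1:ℕ):ℝ) * g) ≤ (((n+1:ℕ):ℝ) * (d/2)) * (Q * (L^(min n N) * E)) := by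
            have : (((n+1:ℕ):ℝ) * (d/2)) * (Q * (L^(min n N) * E)) = C * ((n+1:ℕ):ℝ) * (L^(min n N)) * E * M := by
              rw [hQ]; field_simp
            rw [this]; refine le_trans (le_of_eq ?_) h1; ring
          exact le_of_mul_le_mul_left this (by positivity)
        have hP : 0 ≤ L^(min n N) * E := by positivity
        have hg0 : 0 ≤ g := norm_nonneg _
        rcases Nat.lt_or_ge n N with h3 | h3
        · rw [min_eq_left (by omega : n+1 ≤ N)]
          rw [min_eq_left h3.le] at h2 hP
          have h4 : g ≤ ((n+1:ℕ):ℝ) * g := by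
            have : (1:ℝ) ≤ ((n+1:ℕ):ℝ) := by exact_mod_cast Nat.succ_le_succ (Nat.zero_le n)
            nlinarith
          calc g ≤ Q * (L^n * E) := h4.trans h2
            _ ≤ L * (L^n * E) := by gcongr; exact le_max_right _ _
            _ = _ := by ring
        · rw [min_eq_right (by omega : N ≤ n+1)]
          rw [min_eq_right h3] at h2 hP
          have h5 : (N:ℝ) ≤ ((n+1:ℕ):ℝ) := by exact_mod_cast (by omega : N ≤ n+1)
          have : ((n+1:ℕ):ℝ) * g ≤ ((n+1:ℕ):ℝ) * (L^N * E) := by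
            refine h2.trans ?_
            gcongr
            linarith
          exact le_of_mul_le_mul_left this hn0
  intro n
  refine (claim n).trans ?_
  gcongr
  exact min_le_right _ _

noncomputable def hcT (μ : ℂ) (c : ℕ → ℂ) (n : ℕ) (t : ℝ) : ℂ :=
  Complex.exp (μ * t) * c n * Complex.exp (-(n : ℂ) * t)

lemma hcT_norm (μ : ℂ) (c : ℕ → ℂ) (n : ℕ) (t : ℝ) :
    ‖hcT μ c n t‖ = Real.exp (μ.re * t) * ‖c n‖ * Real.exp (-(n:ℝ) * t) := by
  rw [hcT, norm_mul, norm_mul, Complex.norm_exp, Complex.norm_exp]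
  simp

lemma hc_geom (D s : ℝ) (hs : 0 < s) : Summable (fun n : ℕ => D * Real.exp (-(n:ℝ) * s)) := by
  apply Summable.mul_left
  have : (fun n : ℕ => Real.exp (-(n:ℝ) * s)) = fun n : ℕ => (Real.exp (-s))^n := by
    funext n; rw [← Real.exp_nat_mul]; congr 1; ring
  rw [this]
  exact summable_geometric_of_lt_one (Real.exp_pos _).le (by simpa using hs)

lemma hcT_bound (μ : ℂ) (c : ℕ → ℂ) (n : ℕ) (t s D : ℝ) (hD : 0 < D)
    (hc : ‖c n‖ ≤ D * Real.exp (n * s)) (hst : 2 * s ≤ t) :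
    ‖hcT μ c n t‖ ≤ Real.exp (μ.re * t) * D * Real.exp (-(n:ℝ) * s) := by
  rw [hcT_norm]
  have : D * Real.exp (n * s) * Real.exp (-(n:ℝ) * t) ≤ D * Real.exp (-(n:ℝ) * s) := by
    rw [mul_assoc, ← Real.exp_add]
    gcongr
    have : (0:ℝ) ≤ n := by positivity
    nlinarith
  calc _ ≤ Real.exp (μ.re * t) * (D * Real.exp (n * s)) * Real.exp (-(n:ℝ) * t) := by gcongr
    _ = Real.exp (μ.re * t) * (D * Real.exp (n * s) * Real.exp (-(n:ℝ) * t)) := by ring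
    _ ≤ Real.exp (μ.re * t) * (D * Real.exp (-(n:ℝ) * s)) := by gcongr
    _ = _ := by ring

def hcSub (c : ℕ → ℂ) : Prop := ∀ s : ℝ, 0 < s → ∃ D : ℝ, 0 < D ∧ ∀ n : ℕ, ‖c n‖ ≤ D * Real.exp (n * s)

lemma hcSub_step (μ : ℂ) (c : ℕ → ℂ) (s D : ℝ) (hs : 0 < s) (hD : 0 < D) (n : ℕ)
    (hc : ‖c n‖ ≤ D * Real.exp (n * (s/2))) :
    ‖(μ - n) * c n‖ ≤ ((‖μ‖ + 2/s) * D) * Real.exp (n * s) := by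
  have h1 : ‖μ - n‖ ≤ ‖μ‖ + n := by simpa using norm_sub_le μ (n:ℂ)
  have h2 : n * (s/2) + 1 ≤ Real.exp (n * (s/2)) := Real.add_one_le_exp _
  have h3 : (n:ℝ) ≤ 2/s * Real.exp (n * (s/2)) := by
    rw [div_mul_eq_mul_div, le_div_iff₀ hs]; linarith
  have h4 : 1 ≤ Real.exp (n * (s/2)) := Real.one_le_exp (by positivity)
  have h5 : ‖μ‖ ≤ ‖μ‖ * Real.exp (n * (s/2)) := le_mul_of_one_le_right (norm_nonneg _) h4
  have h6 : ‖μ - n‖ ≤ (‖μ‖ + 2/s) * Real.exp (n * (s/2)) := by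
    rw [add_mul]; linarith
  rw [norm_mul]
  have h7 : Real.exp (n * s) = Real.exp (n * (s/2)) * Real.exp (n * (s/2)) := by
    rw [← Real.exp_add]; congr 1; ring
  rw [h7]
  calc _ ≤ ((‖μ‖ + 2/s) * Real.exp (n * (s/2))) * (D * Real.exp (n * (s/2))) := by gcongr
    _ = _ := by ring

lemma hcSub_mul (μ : ℂ) {c : ℕ → ℂ} (hc : hcSub c) : hcSub (fun n => (μ - n) * c n) := by
  intro s hs
  obtain ⟨D, hD, h⟩ := hc (s/2) (by positivity)
  exact ⟨(‖μ‖ + 2/s) * D, by positivity, fun n => hcSub_step μ c s D hs hD n (h n)⟩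

lemma hcT_summable (μ : ℂ) {c : ℕ → ℂ} (hc : hcSub c) {t : ℝ} (ht : 0 < t) :
    Summable (fun n => ‖hcT μ c n t‖) := by
  obtain ⟨D, hD, h⟩ := hc (t/2) (by positivity)
  refine Summable.of_nonneg_of_le (fun _ => norm_nonneg _)
    (fun n => hcT_bound μ c n t (t/2) D hD (h n) (by linarith)) (hc_geom _ _ (by positivity))

lemma hcT_deriv (μ : ℂ) {c : ℕ → ℂ} (hc : hcSub c) {t : ℝ} (ht : 0 < t) :
    HasDerivAt (fun s : ℝ => ∑' n, hcT μ c n s) (∑' n, hcT μ (fun n => (μ - n) * c n) n t) t := by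
  obtain ⟨D, hD, h⟩ := hcSub_mul μ hc (t/4) (by positivity)
  apply hasDerivAt_tsum_of_isPreconnected (t := Ioo (t/2) (2*t)) (y₀ := t)
    (u := fun n : ℕ => (Real.exp (|μ.re| * (2*t)) * D) * Real.exp (-(n:ℝ) * (t/4)))
    (hc_geom _ _ (by positivity)) isOpen_Ioo isPreconnected_Ioo
  · intro n y hy
    have h1 : HasDerivAt (fun x : ℝ => (x:ℂ)) 1 y := Complex.ofRealCLM.hasDerivAt
    have h2 := (h1.const_mul μ).cexp
    have h3 := (h1.const_mul (-(n:ℂ))).cexp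
    have h4 := (h2.mul_const (c n)).mul h3
    unfold hcT
    convert! h4 using 1
    ring
  · intro n y hy
    refine (hcT_bound μ _ n y (t/4) D hD (h n) (by linarith [hy.1])).trans ?_
    gcongr
    · linarith [hy.1]
    · exact le_abs_self _
    · exact hy.2.le
  · exact ⟨by linarith, by linarith⟩
  · exact (hcT_summable μ hc ht).of_norm
  · exact ⟨by linarith, by linarith⟩

lemma hcT_unif (μ : ℂ) {c : ℕ → ℂ} (hc : hcSub c) {t₀ : ℝ} (ht : 0 < t₀) :
    TendstoUniformlyOn (fun (N : ℕ) (t : ℝ) => ∑ n ∈ Finset.range N, hcT μ c n t)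
      (fun t : ℝ => ∑' n, hcT μ c n t) atTop (Set.Ici t₀) := by
  apply tendstoUniformlyOn_tsum_nat_eventually (hcT_summable μ hc ht)
  obtain ⟨N, hN⟩ := exists_nat_ge μ.re
  filter_upwards [eventually_ge_atTop N] with n hn t htt
  rw [hcT_norm, hcT_norm, mul_right_comm, mul_right_comm _ ‖c n‖, ← Real.exp_add, ← Real.exp_add]
  refine mul_le_mul_of_nonneg_right (Real.exp_le_exp.2 ?_) (norm_nonneg _)
  have : (N:ℝ) ≤ n := by exact_mod_cast hn
  have h2 : t₀ ≤ t := htt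
  nlinarith

lemma hc_cauchy (a : ℕ → ℂ) (μ : ℂ) {c : ℕ → ℂ} (hc : hcSub c) {t : ℝ} (ht : 0 < t)
    (ha : Summable (fun j : ℕ => ‖a j‖ * Real.exp (-(j : ℝ) * t))) :
    HasSum (fun n => hcT μ (fun n => ∑ k ∈ Finset.range (n+1), a (n-k) * c k) n t)
      ((∑' j : ℕ, a j * Complex.exp (-(j:ℂ) * t)) * ∑' n, hcT μ c n t) := by
  have ha' : Summable (fun j : ℕ => ‖a j * Complex.exp (-(j:ℂ) * t)‖) := by
    refine ha.congr fun j => ?_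
    rw [norm_mul, Complex.norm_exp]; simp
  have := hasSum_sum_range_mul_of_summable_norm (hcT_summable μ hc ht) ha'
  rw [mul_comm]
  convert! this using 2 with n
  unfold hcT
  rw [Finset.mul_sum, Finset.sum_mul]
  apply Finset.sum_congr rfl
  intro k hk
  have hk' : k ≤ n := by have := Finset.mem_range.1 hk; omega
  have : Complex.exp (-(n:ℂ) * t) = Complex.exp (-(k:ℂ) * t) * Complex.exp (-((n-k:ℕ):ℂ) * t) := by
    rw [← Complex.exp_add, Nat.cast_sub hk']; congr 1; ring
  rw [this]; ring

lemma hc_main (a : ℕ → ℂ) (ρ : ℂ) (ha0 : a 0 = 2 * ρ)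
    (ha : ∀ t : ℝ, 0 < t → Summable (fun j : ℕ => ‖a j‖ * Real.exp (-(j : ℝ) * t))) (P : ℝ → ℂ)
    (hP : ∀ t : ℝ, 0 < t → HasSum (fun j : ℕ => a j * Complex.exp (-(j:ℂ) * t)) (P t)) :
    ∃ Γ : ℕ → ℂ → ℂ,
      (∀ n : ℕ, DifferentiableOn ℂ (Γ n) {l : ℂ | ∀ m : ℕ, 1 ≤ m → l ≠ -(I * m) / 2}) ∧
      (∀ l : ℂ, Γ 0 l = 1) ∧
      ∀ lam : ℂ, (∀ m : ℕ, 1 ≤ m → lam ≠ -(I * m) / 2) →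
        (∀ t₀ : ℝ, 0 < t₀ →
          (∀ t : ℝ, t₀ ≤ t →
            Summable (fun n : ℕ => ‖hcT (I * lam - ρ) (fun n => Γ n lam) n t‖)) ∧
          TendstoUniformlyOn
            (fun (N : ℕ) (t : ℝ) => ∑ n ∈ Finset.range N, hcT (I * lam - ρ) (fun n => Γ n lam) n t)
            (fun t : ℝ => ∑' n : ℕ, hcT (I * lam - ρ) (fun n => Γ n lam) n t)
            atTop (Set.Ici t₀)) ∧
        (∀ t : ℝ, 0 < t →
          deriv (deriv (fun s : ℝ => ∑' n : ℕ, hcT (I * lam - ρ) (fun n => Γ n lam) n s)) t +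
            P t * deriv (fun s : ℝ => ∑' n : ℕ, hcT (I * lam - ρ) (fun n => Γ n lam) n s) t +
            (lam ^ 2 + ρ ^ 2) *
              (∑' n : ℕ, hcT (I * lam - ρ) (fun n => Γ n lam) n t) = 0) ∧
        (∀ t : ℝ, 0 < t →
          DifferentiableOn ℂ
            (fun l : ℂ => ∑' n : ℕ, hcT (I * l - ρ) (fun n => Γ n l) n t)
            {l : ℂ | ∀ m : ℕ, 1 ≤ m → l ≠ -(I * m) / 2} ∧
          DifferentiableOn ℂ
            (fun l : ℂ => deriv (fun s : ℝ => ∑' n : ℕ, hcT (I * l - ρ) (fun n => Γ n l) n s) t)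
            {l : ℂ | ∀ m : ℕ, 1 ≤ m → l ≠ -(I * m) / 2}) := by
  have hsub : ∀ l : ℂ, (∀ m : ℕ, 1 ≤ m → l ≠ -(I * m) / 2) → hcSub (fun n => hcG a ρ n l) := by
    intro l hl s hs
    obtain ⟨r, hr, _, h⟩ := hcG_bound a ρ ha hl
    obtain ⟨D, hD, h⟩ := h s hs
    exact ⟨D, hD, fun n => h l (Metric.mem_ball_self hr) n⟩
  refine ⟨hcG a ρ, hcG_diff a ρ, hcG_zero a ρ, ?_⟩
  intro l hl
  have hc := hsub l hl
  refine ⟨fun t₀ ht₀ => ⟨fun t ht => hcT_summable _ hc (by linarith), hcT_unif _ hc ht₀⟩, ?_, ?_⟩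
  · intro t ht
    set μ := I * l - ρ with hμ
    have hc1 := hcSub_mul μ hc
    have hc2 := hcSub_mul μ hc1
    have hd2 : deriv (deriv (fun s : ℝ => ∑' n : ℕ, hcT μ (fun n => hcG a ρ n l) n s)) t =
        ∑' n, hcT μ (fun n => (μ - n) * ((μ - n) * hcG a ρ n l)) n t := by
      rw [← (hcT_deriv μ hc1 ht).deriv]
      apply Filter.EventuallyEq.deriv_eq
      filter_upwards [lt_mem_nhds ht] with s hs
      exact (hcT_deriv μ hc hs).deriv
    rw [hd2, (hcT_deriv μ hc ht).deriv, ← (hP t ht).tsum_eq]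
    have s1 := (hcT_summable μ hc2 ht).of_norm.hasSum
    have s2 := hc_cauchy a μ hc1 ht (ha t ht)
    have s3 := ((hcT_summable μ hc ht).of_norm.hasSum).mul_left (l^2 + ρ^2)
    have s4 := (s1.add s2).add s3
    refine s4.unique ?_
    convert! hasSum_zero using 2 with n
    have hrec := hcG_rec a ρ hl n
    unfold hcT
    simp only [Finset.sum_range_succ, Nat.sub_self, ha0]
    have hrec' : ∑ k ∈ Finset.range n, a (n-k) * ((μ - (k:ℂ)) * hcG a ρ k l) =
        -((n:ℂ) * ((n:ℂ) - 2*I*l) * hcG a ρ n l) := by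
      rw [hrec, neg_neg]
      exact Finset.sum_congr rfl fun k _ => by rw [hμ]; ring
    rw [hrec', hμ]
    have hI : Complex.I^2 = -1 := I_sq
    linear_combination (Complex.exp ((I*l-ρ) * t) * hcG a ρ n l * Complex.exp (-(n:ℂ) * t) * l^2) * hI
  · intro t ht
    have hexp : ∀ μ : ℂ, ∀ R : ℝ, ‖μ‖ ≤ R → Real.exp (μ.re * t) ≤ Real.exp (R * t) := by
      intro μ R h
      gcongr
      exact (Complex.re_le_norm μ).trans h
    constructor
    · intro l₀ hl₀
      obtain ⟨r, hr, hm, h⟩ := hcG_bound a ρ ha hl₀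
      obtain ⟨D, hD, h⟩ := h (t/2) (by positivity)
      have hR : ∀ l ∈ Metric.ball l₀ r, ‖I*l-ρ‖ ≤ ‖l₀‖ + r + ‖ρ‖ := by
        intro l hl
        have h4 : ‖l-l₀‖ < r := by simpa [dist_eq_norm] using hl
        have h5 : ‖l‖ ≤ ‖l₀‖ + ‖l-l₀‖ := by
          have := norm_add_le l₀ (l-l₀); simpa using this
        have := norm_sub_le (I*l) ρ
        simp at this
        linarith
      have := differentiableOn_tsum_of_summable_norm
        (F := fun n l => hcT (I*l-ρ) (fun n => hcG a ρ n l) n t)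
        (hc_geom (Real.exp ((‖l₀‖ + r + ‖ρ‖) * t) * D) (t/2) (by positivity))
        (U := Metric.ball l₀ r) ?_ Metric.isOpen_ball ?_
      · exact (this.differentiableAt (Metric.ball_mem_nhds _ hr)).differentiableWithinAt
      · intro n
        have := (hcG_diff a ρ n).mono (t := {l : ℂ | ∀ m : ℕ, 1 ≤ m → l ≠ -(I * m) / 2}) (fun l hl => hm l hl)
        unfold hcT
        fun_prop
      · intro n l hl
        refine (hcT_bound _ _ n t (t/2) D hD (h l hl n) (by linarith)).trans ?_
        have := hexp _ _ (hR l hl)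
        gcongr
    · intro l₀ hl₀
      obtain ⟨r, hr, hm, h⟩ := hcG_bound a ρ ha hl₀
      obtain ⟨D, hD, h⟩ := h ((t/2)/2) (by positivity)
      have hR : ∀ l ∈ Metric.ball l₀ r, ‖I*l-ρ‖ ≤ ‖l₀‖ + r + ‖ρ‖ := by
        intro l hl
        have h4 : ‖l-l₀‖ < r := by simpa [dist_eq_norm] using hl
        have h5 : ‖l‖ ≤ ‖l₀‖ + ‖l-l₀‖ := by
          have := norm_add_le l₀ (l-l₀); simpa using this
        have := norm_sub_le (I*l) ρ
        simp at this
        linarith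
      have key := differentiableOn_tsum_of_summable_norm
        (F := fun n l => hcT (I*l-ρ) (fun n => ((I*l-ρ) - n) * hcG a ρ n l) n t)
        (hc_geom (Real.exp ((‖l₀‖ + r + ‖ρ‖) * t) * (((‖l₀‖ + r + ‖ρ‖) + 2/(t/2)) * D)) (t/2) (by positivity))
        (U := Metric.ball l₀ r) ?_ Metric.isOpen_ball ?_
      · have key2 := key.differentiableAt (Metric.ball_mem_nhds _ hr)
        apply DifferentiableAt.differentiableWithinAt
        refine key2.congr_of_eventuallyEq ?_
        filter_upwards [Metric.ball_mem_nhds l₀ hr] with l hl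
        exact (hcT_deriv _ (hsub l (hm l hl)) ht).deriv
      · intro n
        have := (hcG_diff a ρ n).mono (t := {l : ℂ | ∀ m : ℕ, 1 ≤ m → l ≠ -(I * m) / 2}) (fun l hl => hm l hl)
        unfold hcT
        fun_prop
      · intro n l hl
        have hb := hcSub_step (I*l-ρ) (fun n => hcG a ρ n l) (t/2) D (by positivity) hD n (h l hl n)
        refine (hcT_bound _ _ n t (t/2) _ (by positivity) hb (by linarith)).trans ?_
        have := hexp _ _ (hR l hl)
        have := hR l hl
        gcongr

lemma hc_coth {t : ℝ} (ht : 0 < t) :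
    HasSum (fun j : ℕ => ((1:ℂ)^j + (-1)^j - (if j = 0 then 1 else 0)) * Complex.exp (-(j:ℂ) * t))
      (Complex.cosh t / Complex.sinh t) := by
  set x : ℂ := Complex.exp (-(t:ℂ)) with hx
  have hxn : ‖x‖ < 1 := by
    rw [hx, Complex.norm_exp]; simpa using ht
  have hx0 : x ≠ 0 := Complex.exp_ne_zero _
  have hpow : ∀ j : ℕ, Complex.exp (-(j:ℂ) * t) = x^j := by
    intro j; rw [hx, ← Complex.exp_nat_mul]; congr 1; ring
  have g1 := hasSum_geometric_of_norm_lt_one (ξ := x) hxn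
  have g2 := hasSum_geometric_of_norm_lt_one (ξ := -x) (by simpa using hxn)
  have g3 := hasSum_ite_eq (0:ℕ) (1:ℂ)
  have hs := (g1.add g2).sub g3
  have n1 : 1 - x ≠ 0 := by
    intro h; rw [← sub_eq_zero.1 h] at hxn; simp at hxn
  have n2 : 1 + x ≠ 0 := by
    intro h; rw [eq_neg_of_add_eq_zero_right h] at hxn; simp at hxn
  have hex : Complex.exp t = x⁻¹ := by rw [hx, Complex.exp_neg, inv_inv]
  convert! hs using 1
  · funext j
    rw [hpow]
    by_cases hj : j = 0
    · subst hj; simp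
    · simp [hj, neg_pow x]; ring
  · have hch : Complex.cosh t = (Complex.exp t + Complex.exp (-t)) / 2 := rfl
    have hsh : Complex.sinh t = (Complex.exp t - Complex.exp (-t)) / 2 := rfl
    rw [hch, hsh, hex, ← hx, sub_neg_eq_add]
    have n3 : 1 - x^2 ≠ 0 := by
      have : 1 - x^2 = (1-x)*(1+x) := by ring
      rw [this]; exact mul_ne_zero n1 n2
    have n4 : x⁻¹ - x ≠ 0 := by
      have : x⁻¹ - x = (1-x^2)/x := by field_simp
      rw [this]; exact div_ne_zero n3 hx0
    field_simp
    ring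

lemma hc_tanh {t : ℝ} (ht : 0 < t) :
    HasSum (fun j : ℕ => (Complex.I^j + (-I)^j - (if j = 0 then 1 else 0)) * Complex.exp (-(j:ℂ) * t))
      (Complex.sinh t / Complex.cosh t) := by
  set x : ℂ := Complex.exp (-(t:ℂ)) with hx
  have hxn : ‖x‖ < 1 := by
    rw [hx, Complex.norm_exp]; simpa using ht
  have hx0 : x ≠ 0 := Complex.exp_ne_zero _
  have hpow : ∀ j : ℕ, Complex.exp (-(j:ℂ) * t) = x^j := by
    intro j; rw [hx, ← Complex.exp_nat_mul]; congr 1; ring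
  have g1 := hasSum_geometric_of_norm_lt_one (ξ := I*x) (by simpa using hxn)
  have g2 := hasSum_geometric_of_norm_lt_one (ξ := -(I*x)) (by simpa using hxn)
  have g3 := hasSum_ite_eq (0:ℕ) (1:ℂ)
  have hs := (g1.add g2).sub g3
  have hy : ‖I*x‖ < 1 := by simpa using hxn
  have n1 : 1 - I*x ≠ 0 := by
    intro h; rw [← sub_eq_zero.1 h] at hy; simp at hy
  have n2 : 1 + I*x ≠ 0 := by
    intro h; rw [eq_neg_of_add_eq_zero_right h] at hy; simp at hy
  have hex : Complex.exp t = x⁻¹ := by rw [hx, Complex.exp_neg, inv_inv]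
  convert! hs using 1
  · funext j
    rw [hpow]
    by_cases hj : j = 0
    · subst hj; simp
    · simp [hj, neg_pow (I*x), neg_pow I, mul_pow]; ring
  · have hch : Complex.cosh t = (Complex.exp t + Complex.exp (-t)) / 2 := rfl
    have hsh : Complex.sinh t = (Complex.exp t - Complex.exp (-t)) / 2 := rfl
    rw [hch, hsh, hex, ← hx, sub_neg_eq_add]
    have e3 : (1 - I*x)*(1+I*x) = 1 + x^2 := by linear_combination -x^2 * I_sq
    have n3 : 1 + x^2 ≠ 0 := by
      rw [← e3]; exact mul_ne_zero n1 n2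
    have e5 : (1 - I*x)⁻¹ + (1+I*x)⁻¹ = 2 / (1+x^2) := by
      rw [← e3]; field_simp; ring
    have e4 : x⁻¹ + x = (1+x^2)/x := by field_simp
    have e6 : x⁻¹ - x = (1-x^2)/x := by field_simp
    rw [e5, e4, e6]
    field_simp
    ring

/-- Construction of the second solution `Φ_λ(t) = e^{(iλ-ρ)t} ∑ Γ_n(λ) e^{-nt}` of the
Sturm–Liouville equation, for `ρ > 0`, with `Γ_n` holomorphic on
`𝒟 = ℂ ∖ {-im/2 : m ≥ 1}` and `Γ_0 ≡ 1`: (i) the series converges absolutely and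
uniformly on `[t₀,∞)` for every `t₀ > 0`; (ii) `Φ_λ` solves the equation on `(0,∞)`;
(iii) `λ ↦ Φ_λ(t)` and `λ ↦ Φ_λ'(t)` are holomorphic on `𝒟` for each fixed `t > 0`. -/
theorem stmt_7 (α β : ℝ) (hα : -(1/2 : ℝ) ≤ α) (hβ : -(1/2 : ℝ) ≤ β)
    (B : ℂ → ℂ)
    (hBhol : DifferentiableOn ℂ B {z : ℂ | |z.im| < π/2})
    (hBne : ∀ z : ℂ, |z.im| < π/2 → B z ≠ 0)
    (hBeven : ∀ z : ℂ, |z.im| < π/2 → B (-z) = B z)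
    (hBposR : ∀ t : ℝ, 0 < (B t).re ∧ (B t).im = 0)
    (hBposI : ∀ s : ℝ, |s| < π/2 → 0 < (B (s * I)).re ∧ (B (s * I)).im = 0)
    (Af : ℂ → ℂ)
    (hAf : ∀ z : ℂ, Af z =
      Complex.sinh z ^ (2 * (α : ℂ) + 1) * Complex.cosh z ^ (2 * (β : ℂ) + 1) * B z)
    (ρ : ℝ) (hρpos : 0 < ρ)
    (hρ : Tendsto (fun t : ℝ => deriv Af t / Af t) atTop (𝓝 ((2 * ρ : ℝ) : ℂ)))
    (b : ℕ → ℝ)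
    (hbabs : ∀ t : ℝ, 0 < t → Summable (fun j : ℕ => |b j| * Real.exp (-(j : ℝ) * t)))
    (hb : ∀ t : ℝ, 0 < t →
      HasSum (fun j : ℕ => ((2 * b j * Real.exp (-(j : ℝ) * t) : ℝ) : ℂ))
        (deriv B t / B t))
    (hρval : ρ = α + β + 1 + b 0) :
    ∃ Γ : ℕ → ℂ → ℂ,
      (∀ n : ℕ, DifferentiableOn ℂ (Γ n) {l : ℂ | ∀ m : ℕ, 1 ≤ m → l ≠ -(I * m) / 2}) ∧
      (∀ l : ℂ, Γ 0 l = 1) ∧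
      ∀ lam : ℂ, (∀ m : ℕ, 1 ≤ m → lam ≠ -(I * m) / 2) →
        (∀ t₀ : ℝ, 0 < t₀ →
          (∀ t : ℝ, t₀ ≤ t →
            Summable (fun n : ℕ =>
              ‖Complex.exp ((I * lam - (ρ : ℂ)) * t) * Γ n lam * Complex.exp (-(n : ℂ) * t)‖)) ∧
          TendstoUniformlyOn
            (fun (N : ℕ) (t : ℝ) => ∑ n ∈ Finset.range N,
              Complex.exp ((I * lam - (ρ : ℂ)) * t) * Γ n lam * Complex.exp (-(n : ℂ) * t))
            (fun t : ℝ => ∑' n : ℕ,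
              Complex.exp ((I * lam - (ρ : ℂ)) * t) * Γ n lam * Complex.exp (-(n : ℂ) * t))
            atTop (Set.Ici t₀)) ∧
        (∀ t : ℝ, 0 < t →
          deriv (deriv (fun s : ℝ => ∑' n : ℕ,
              Complex.exp ((I * lam - (ρ : ℂ)) * s) * Γ n lam * Complex.exp (-(n : ℂ) * s))) t +
            (deriv Af t / Af t) *
              deriv (fun s : ℝ => ∑' n : ℕ,
                Complex.exp ((I * lam - (ρ : ℂ)) * s) * Γ n lam * Complex.exp (-(n : ℂ) * s)) t +
            (lam ^ 2 + (ρ : ℂ) ^ 2) *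
              (∑' n : ℕ,
                Complex.exp ((I * lam - (ρ : ℂ)) * t) * Γ n lam * Complex.exp (-(n : ℂ) * t)) = 0) ∧
        (∀ t : ℝ, 0 < t →
          DifferentiableOn ℂ
            (fun l : ℂ => ∑' n : ℕ,
              Complex.exp ((I * l - (ρ : ℂ)) * t) * Γ n l * Complex.exp (-(n : ℂ) * t))
            {l : ℂ | ∀ m : ℕ, 1 ≤ m → l ≠ -(I * m) / 2} ∧
          DifferentiableOn ℂ
            (fun l : ℂ => deriv (fun s : ℝ => ∑' n : ℕ,
              Complex.exp ((I * l - (ρ : ℂ)) * s) * Γ n l * Complex.exp (-(n : ℂ) * s)) t)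
            {l : ℂ | ∀ m : ℕ, 1 ≤ m → l ≠ -(I * m) / 2}) := by
  set a : ℕ → ℂ := fun j => 2 * (b j : ℂ) +
      (2 * (α : ℂ) + 1) * ((1:ℂ)^j + (-1)^j - (if j = 0 then 1 else 0)) +
      (2 * (β : ℂ) + 1) * (Complex.I^j + (-I)^j - (if j = 0 then 1 else 0)) with ha_def
  have ha0 : a 0 = 2 * (ρ : ℂ) := by
    rw [hρval, ha_def]; push_cast; simp; ring
  have hdelta : ∀ j : ℕ, ‖(if j = 0 then 1 else 0 : ℂ)‖ ≤ 1 := by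
    intro j; split_ifs <;> simp
  have ha : ∀ t : ℝ, 0 < t → Summable (fun j : ℕ => ‖a j‖ * Real.exp (-(j : ℝ) * t)) := by
    intro t ht
    have hs := ((hbabs t ht).mul_left 2).add
      (hc_geom (‖2 * (α : ℂ) + 1‖ * 3 + ‖2 * (β : ℂ) + 1‖ * 3) t ht)
    refine Summable.of_nonneg_of_le (fun j => by positivity) (fun j => ?_) hs
    rw [← mul_assoc, ← add_mul]
    gcongr
    have h1 : ‖(1:ℂ)^j + (-1)^j - (if j = 0 then 1 else 0)‖ ≤ 3 := by
      have e1 := norm_sub_le ((1:ℂ)^j + (-1)^j) (if j = 0 then 1 else 0)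
      have e2 := norm_add_le ((1:ℂ)^j) ((-1)^j)
      have e3 := hdelta j
      rw [norm_pow, norm_pow] at e2
      simp only [norm_neg, norm_one, one_pow] at e2
      simp only [one_pow] at e1 ⊢
      linarith
    have h2 : ‖Complex.I^j + (-I)^j - (if j = 0 then 1 else 0)‖ ≤ 3 := by
      have e1 := norm_sub_le (Complex.I^j + (-I)^j) (if j = 0 then 1 else 0)
      have e2 := norm_add_le (Complex.I^j) ((-I)^j)
      have e3 := hdelta j
      rw [norm_pow, norm_pow] at e2
      simp only [norm_neg, Complex.norm_I, one_pow] at e2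
      linarith
    rw [ha_def]
    refine (norm_add_le _ _).trans ?_
    have e1 := norm_add_le (2 * (b j : ℂ)) ((2 * (α : ℂ) + 1) * ((1:ℂ)^j + (-1)^j - (if j = 0 then 1 else 0)))
    have e2 : ‖2 * (b j : ℂ)‖ = 2 * |b j| := by simp
    rw [e2, norm_mul] at e1
    rw [norm_mul (2 * (β : ℂ) + 1)]
    have e3 := mul_le_mul_of_nonneg_left h1 (norm_nonneg (2 * (α : ℂ) + 1))
    have e4 := mul_le_mul_of_nonneg_left h2 (norm_nonneg (2 * (β : ℂ) + 1))
    linarith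
  have hP : ∀ t : ℝ, 0 < t → HasSum (fun j : ℕ => a j * Complex.exp (-(j:ℂ) * t))
      (deriv Af t / Af t) := by
    intro t ht
    have hsinh : (0:ℝ) < Real.sinh t := Real.sinh_pos_iff.2 ht
    have hcosh : (0:ℝ) < Real.cosh t := Real.cosh_pos t
    have s1 : Complex.sinh t ∈ slitPlane := by
      rw [← Complex.ofReal_sinh]; exact Complex.ofReal_mem_slitPlane.2 hsinh
    have c1 : Complex.cosh t ∈ slitPlane := by
      rw [← Complex.ofReal_cosh]; exact Complex.ofReal_mem_slitPlane.2 hcosh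
    have s0 := slitPlane_ne_zero s1
    have c0 := slitPlane_ne_zero c1
    have hmem : |(t:ℂ).im| < π/2 := by simp [Real.pi_pos]
    have hB0 := hBne t hmem
    have hopen : IsOpen {z : ℂ | |z.im| < π/2} :=
      isOpen_lt (by fun_prop) continuous_const
    have hBd : HasDerivAt B (deriv B t) (t:ℂ) :=
      (hBhol.differentiableAt (hopen.mem_nhds hmem)).hasDerivAt
    have d1 := (Complex.hasDerivAt_sinh (t:ℂ)).cpow_const (c := 2 * (α : ℂ) + 1) s1
    have d2 := (Complex.hasDerivAt_cosh (t:ℂ)).cpow_const (c := 2 * (β : ℂ) + 1) c1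
    have d3 := (d1.mul d2).mul hBd
    have hfun : Af = _ := funext hAf
    have hval : deriv Af t / Af t = deriv B t / B t +
        (2 * (α : ℂ) + 1) * (Complex.cosh t / Complex.sinh t) +
        (2 * (β : ℂ) + 1) * (Complex.sinh t / Complex.cosh t) := by
      have hAd := d3.deriv
      rw [show (((fun x => Complex.sinh x ^ (2 * (α:ℂ) + 1)) * fun x => Complex.cosh x ^ (2 * (β:ℂ) + 1)) * B) = Af from hfun.symm] at hAd
      rw [hAd, hAf t]
      have p1 : Complex.sinh t ^ (2 * (α : ℂ) + 1) ≠ 0 := by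
        rw [Complex.cpow_def_of_ne_zero s0]; exact Complex.exp_ne_zero _
      have p2 : Complex.cosh t ^ (2 * (β : ℂ) + 1) ≠ 0 := by
        rw [Complex.cpow_def_of_ne_zero c0]; exact Complex.exp_ne_zero _
      rw [Complex.cpow_sub _ _ s0, Complex.cpow_sub _ _ c0, Complex.cpow_one, Complex.cpow_one]
      simp only [Pi.mul_apply]
      generalize Complex.sinh t ^ (2 * (α : ℂ) + 1) = X at *
      generalize Complex.cosh t ^ (2 * (β : ℂ) + 1) = Y at *
      field_simp
      ring
    rw [hval]
    have hs := ((hb t ht).add ((hc_coth ht).mul_left (2 * (α : ℂ) + 1))).add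
      ((hc_tanh ht).mul_left (2 * (β : ℂ) + 1))
    convert! hs using 1
    funext j
    rw [ha_def]
    push_cast
    ring
  exact hc_main a ρ ha0 ha (fun t : ℝ => deriv Af t / Af t) hP
end

section
/- Let α, β ≥ −1/2 and ρ = α + β + 1, and let G be the holomorphic extension to Ω = {z ∈ ℂ : |Im z| < π/2} of G(z) = ((α + 1/2)² − (α + 1/2)) coth²(z) + ((β + 1/2)² − (β + 1/2)) tanh²(z) + (α + 1/2) + (β + 1/2) + 2(α + 1/2)(β + 1/2) − ρ² − (α² − 1/4)/z². Then for every s with |s| < π/2, the function t ↦ G(t + is) belongs to L¹(ℝ); that is, G is integrable along every straight line contained in Ω. -/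
open Complex Real Set Filter MeasureTheory Topology

lemma aux_self_le_sinh_sq (t : ℝ) : t ^ 2 ≤ Real.sinh t ^ 2 := by
  rw [← sq_abs t, ← sq_abs (Real.sinh t), Real.abs_sinh]
  have := Real.self_le_sinh_iff.2 (abs_nonneg t)
  have := abs_nonneg t
  gcongr

lemma aux_sinh_le (t : ℝ) (ht : 0 ≤ t) : Real.sinh t ≤ t * Real.cosh t := by
  have hd : ∀ x : ℝ, HasDerivAt (fun x => x * Real.cosh x - Real.sinh x) (x * Real.sinh x) x := by
    intro x
    have := ((hasDerivAt_id x).mul (Real.hasDerivAt_cosh x)).sub (Real.hasDerivAt_sinh x)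
    exact this.congr_deriv (by simp only [id]; ring)
  have hm : MonotoneOn (fun x => x * Real.cosh x - Real.sinh x) (Ici (0:ℝ)) := by
    apply monotoneOn_of_deriv_nonneg (convex_Ici 0)
    · exact fun x _ => (hd x).continuousAt.continuousWithinAt
    · exact fun x _ => (hd x).differentiableAt.differentiableWithinAt
    · intro x hx
      rw [interior_Ici] at hx
      rw [(hd x).deriv]
      exact mul_nonneg hx.le (Real.sinh_nonneg_iff.2 hx.le)
  have := hm (mem_Ici.2 le_rfl) (mem_Ici.2 ht) ht
  simp at this
  linarith

lemma aux_sinh_sq_le (t : ℝ) : Real.sinh t ^ 2 ≤ t ^ 2 + t ^ 2 * Real.sinh t ^ 2 := by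
  have h := aux_sinh_le |t| (abs_nonneg t)
  have h0 := Real.sinh_nonneg_iff.2 (abs_nonneg t)
  have h2 : Real.sinh |t| ^ 2 ≤ (|t| * Real.cosh |t|) ^ 2 := by gcongr
  rw [mul_pow, ← Real.abs_sinh, sq_abs, sq_abs, Real.cosh_abs, Real.cosh_sq] at h2
  linarith

lemma aux_normSq_cosh (t s : ℝ) :
    ‖Complex.cosh ((t : ℂ) + (s : ℂ) * I)‖ ^ 2 = Real.sinh t ^ 2 + Real.cos s ^ 2 := by
  rw [← Complex.normSq_eq_norm_sq, Complex.cosh_add, Complex.cosh_mul_I, Complex.sinh_mul_I,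
    ← Complex.ofReal_cosh, ← Complex.ofReal_sinh, ← Complex.ofReal_cos, ← Complex.ofReal_sin,
    ← mul_assoc, ← Complex.ofReal_mul, ← Complex.ofReal_mul, Complex.normSq_add_mul_I]
  have h1 := Real.cosh_sq t
  have h2 := Real.sin_sq_add_cos_sq s
  linear_combination Real.cos s ^ 2 * h1 + Real.sinh t ^ 2 * h2

lemma aux_normSq_sinh (t s : ℝ) :
    ‖Complex.sinh ((t : ℂ) + (s : ℂ) * I)‖ ^ 2 = Real.sinh t ^ 2 + Real.sin s ^ 2 := by
  rw [← Complex.normSq_eq_norm_sq, Complex.sinh_add, Complex.cosh_mul_I, Complex.sinh_mul_I,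
    ← Complex.ofReal_cosh, ← Complex.ofReal_sinh, ← Complex.ofReal_cos, ← Complex.ofReal_sin,
    ← mul_assoc, ← Complex.ofReal_mul, ← Complex.ofReal_mul, Complex.normSq_add_mul_I]
  have h1 := Real.cosh_sq t
  have h2 := Real.sin_sq_add_cos_sq s
  linear_combination Real.sin s ^ 2 * h1 + Real.sinh t ^ 2 * h2

lemma aux_int (f : ℂ → ℂ) (hf : Measurable f) (s c : ℝ) (hc : c ≠ 0) (hc1 : c ^ 2 ≤ 1)
    (h : ∀ t : ℝ, t ^ 2 + c ^ 2 ≤ ‖f ((t : ℂ) + (s : ℂ) * I)‖ ^ 2) :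
    Integrable (fun t : ℝ => 1 / f ((t : ℂ) + (s : ℂ) * I) ^ 2) := by
  refine ((integrable_inv_one_add_sq).const_mul (c ^ 2)⁻¹).mono' ?_ (ae_of_all _ fun t => ?_)
  · exact Measurable.aestronglyMeasurable (by fun_prop)
  · have hcp : 0 < c ^ 2 := by positivity
    rw [norm_div, norm_one, norm_pow, ← mul_inv, ← one_div]
    apply one_div_le_one_div_of_le (by positivity)
    nlinarith [h t, sq_nonneg t]

lemma aux_real (t : ℝ) : ‖1 / Real.sinh t ^ 2 - 1 / t ^ 2‖ ≤ 2 * (1 + t ^ 2)⁻¹ := by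
  rcases eq_or_ne t 0 with rfl | ht
  · simp
  have h1 := aux_self_le_sinh_sq t
  have h2 := aux_sinh_sq_le t
  have htp : 0 < t ^ 2 := by positivity
  have hsp : 0 < Real.sinh t ^ 2 := by linarith
  rw [norm_sub_rev, Real.norm_of_nonneg
    (sub_nonneg.2 (one_div_le_one_div_of_le htp h1)), ← div_eq_mul_inv]
  have e : 1 / t ^ 2 - 1 / Real.sinh t ^ 2 ≤ 1 := by
    rw [div_sub_div _ _ htp.ne' hsp.ne', div_le_one (by positivity)]
    linarith
  have e2 : 1 / t ^ 2 - 1 / Real.sinh t ^ 2 ≤ 1 / t ^ 2 := by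
    have : 0 < 1 / Real.sinh t ^ 2 := by positivity
    linarith
  rw [le_div_iff₀ (by positivity)]
  have e3 : (1 / t ^ 2 - 1 / Real.sinh t ^ 2) * t ^ 2 ≤ 1 := by
    calc _ ≤ 1 / t ^ 2 * t ^ 2 := by gcongr
      _ = 1 := by field_simp
  linarith

lemma aux_sinh_int (s : ℝ) (hs : |s| < π / 2) :
    Integrable (fun t : ℝ => 1 / Complex.sinh ((t : ℂ) + (s : ℂ) * I) ^ 2
      - 1 / ((t : ℂ) + (s : ℂ) * I) ^ 2) := by
  rcases eq_or_ne s 0 with rfl | h0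
  · refine ((integrable_inv_one_add_sq).const_mul 2).mono' ?_ (ae_of_all _ fun t => ?_)
    · exact Measurable.aestronglyMeasurable (by fun_prop)
    · have := aux_real t
      rw [← Complex.norm_real] at this
      simpa using this
  · have hs' := abs_lt.1 hs
    have hsin : Real.sin s ≠ 0 := by
      rw [Ne, Real.sin_eq_zero_iff_of_lt_of_lt (by linarith [Real.pi_pos]) (by linarith [Real.pi_pos])]
      exact h0
    have hle : Real.sin s ^ 2 ≤ 1 := Real.sin_sq_le_one s
    refine (aux_int Complex.sinh Complex.measurable_sinh s _ hsin hle fun t => ?_).sub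
      (aux_int id measurable_id s _ hsin hle fun t => ?_)
    · rw [aux_normSq_sinh]
      linarith [aux_self_le_sinh_sq t]
    · rw [id, ← Complex.normSq_eq_norm_sq, Complex.normSq_add_mul_I]
      have : Real.sin s ^ 2 ≤ s ^ 2 := Real.sin_sq_le_sq
      linarith

lemma aux_cosh_int (s : ℝ) (hs : |s| < π / 2) :
    Integrable (fun t : ℝ => 1 / Complex.cosh ((t : ℂ) + (s : ℂ) * I) ^ 2) := by
  have hs' := abs_lt.1 hs
  refine aux_int Complex.cosh Complex.measurable_cosh s (Real.cos s)
    (Real.cos_pos_of_mem_Ioo ⟨by linarith, by linarith⟩).ne' (Real.cos_sq_le_one s) fun t => ?_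
  rw [aux_normSq_cosh]
  linarith [aux_self_le_sinh_sq t]

/-- In the non-perturbed case `B ≡ 1`, the function
`G(z) = ((α+1/2)² - (α+1/2)) coth²z + ((β+1/2)² - (β+1/2)) tanh²z + (α+1/2) + (β+1/2)
 + 2(α+1/2)(β+1/2) - ρ² - (α² - 1/4)/z²` (with `ρ = α + β + 1`) is integrable along
every horizontal line `{t + is : t ∈ ℝ}` contained in the strip `{|Im z| < π/2}`. -/
theorem stmt_11 (α β : ℝ) (hα : -(1/2 : ℝ) ≤ α) (hβ : -(1/2 : ℝ) ≤ β)
    (ρ : ℝ) (hρ : ρ = α + β + 1)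
    (G : ℂ → ℂ)
    (hG : ∀ z : ℂ, G z =
      (((α : ℂ) + 1/2) ^ 2 - ((α : ℂ) + 1/2)) * (Complex.cosh z / Complex.sinh z) ^ 2 +
      (((β : ℂ) + 1/2) ^ 2 - ((β : ℂ) + 1/2)) * (Complex.sinh z / Complex.cosh z) ^ 2 +
      ((α : ℂ) + 1/2) + ((β : ℂ) + 1/2) + 2 * ((α : ℂ) + 1/2) * ((β : ℂ) + 1/2) -
      (ρ : ℂ) ^ 2 - ((α : ℂ) ^ 2 - 1/4) / z ^ 2) :
    ∀ s : ℝ, |s| < π/2 → Integrable (fun t : ℝ => G ((t : ℂ) + (s : ℂ) * I)) := by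
  intro s hs
  refine (((aux_sinh_int s hs).const_mul (((α : ℂ) + 1/2) ^ 2 - ((α : ℂ) + 1/2))).sub
    ((aux_cosh_int s hs).const_mul (((β : ℂ) + 1/2) ^ 2 - ((β : ℂ) + 1/2)))).congr ?_
  have hne : ∀ᵐ t : ℝ, t ≠ 0 := by simp [ae_iff]
  filter_upwards [hne] with t ht
  have hsp : 0 < t ^ 2 := by positivity
  have h1 := aux_self_le_sinh_sq t
  have hS : Complex.sinh ((t : ℂ) + (s : ℂ) * I) ≠ 0 := by
    intro h
    have := aux_normSq_sinh t s
    rw [h] at this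
    simp at this
    nlinarith [sq_nonneg (Real.sin s)]
  have hC : Complex.cosh ((t : ℂ) + (s : ℂ) * I) ≠ 0 := by
    intro h
    have := aux_normSq_cosh t s
    rw [h] at this
    simp at this
    nlinarith [sq_nonneg (Real.cos s)]
  simp only [Pi.sub_apply]
  rw [hG, hρ]
  generalize (t : ℂ) + (s : ℂ) * I = z at *
  have hid := Complex.cosh_sq z
  have e1 : (Complex.cosh z / Complex.sinh z) ^ 2 = 1 + 1 / Complex.sinh z ^ 2 := by
    rw [div_pow, hid]; field_simp
  have e2 : (Complex.sinh z / Complex.cosh z) ^ 2 = 1 - 1 / Complex.cosh z ^ 2 := by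
    rw [div_pow, eq_sub_iff_add_eq, ← add_div, ← hid]; field_simp
  rw [e1, e2]
  push_cast
  ring
end

section
/- Let 0 < A < π/2, p > 0, 0 < δ ≤ 1, and let a be holomorphic on {λ ∈ ℂ : Im λ > −δ} with |a(λ)| ≤ C e^{−p Im λ + A|Re λ|} there. Let (μ_m)_{m≥0} be positive reals with μ_m ≥ c_0 m for some c_0 > 0 and all large m, let (e_m) be complex numbers with |e_m| ≤ C_1 (1 + μ_m)^{N} for some N, and let (Ψ_m) be holomorphic functions on {t ∈ ℂ : |Re t| < π/2} satisfying |Ψ_m(t + is)| ≤ C_2 Q(μ_m) |P(t + is)| e^{|s| μ_m} for fixed polynomials P, Q independent of m. Then the series f(t) = Σ_{m=0}^∞ e_m a(i μ_m) Ψ_m(t) converges absolutely and uniformly on compact subsets of Ω_p = {t ∈ ℂ : |Re t| < π/2, |Im t| < p} and defines a holomorphic function on Ω_p. -/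
open Complex Real Set Filter MeasureTheory Topology

/-- Series part of Ramanujan's master theorem for the Sturm–Liouville operator: the series
`f(t) = ∑ eₘ a(iμₘ) Ψₘ(t)` converges absolutely and uniformly on compact subsets of
`Ω_p = {|Re t| < π/2, |Im t| < p}` and defines a holomorphic function there. -/
theorem stmt_17 (A p δ : ℝ) (hA0 : 0 < A) (hA : A < π/2) (hp : 0 < p)
    (hδ0 : 0 < δ) (hδ1 : δ ≤ 1)
    (a : ℂ → ℂ) (ha : DifferentiableOn ℂ a {z : ℂ | -δ < z.im})
    (C : ℝ)
    (haC : ∀ z : ℂ, -δ < z.im → ‖a z‖ ≤ C * Real.exp (-p * z.im + A * |z.re|))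
    (μ : ℕ → ℝ) (hμpos : ∀ m, 0 < μ m)
    (c₀ : ℝ) (hc₀ : 0 < c₀) (M₀ : ℕ) (hμ : ∀ m : ℕ, M₀ ≤ m → c₀ * m ≤ μ m)
    (e : ℕ → ℂ) (C₁ : ℝ) (N : ℕ)
    (he : ∀ m : ℕ, ‖e m‖ ≤ C₁ * (1 + μ m) ^ N)
    (Ψ : ℕ → ℂ → ℂ)
    (hΨhol : ∀ m : ℕ, DifferentiableOn ℂ (Ψ m) {t : ℂ | |t.re| < π/2})
    (C₂ : ℝ) (P : Polynomial ℂ) (Q : Polynomial ℝ)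
    (hΨ : ∀ m : ℕ, ∀ z : ℂ, |z.re| < π/2 →
      ‖Ψ m z‖ ≤ C₂ * |Q.eval (μ m)| * ‖P.eval z‖ * Real.exp (|z.im| * μ m)) :
    (∀ t : ℂ, |t.re| < π/2 → |t.im| < p →
      Summable (fun m : ℕ => ‖e m * a (I * (μ m : ℂ)) * Ψ m t‖)) ∧
    (∀ K : Set ℂ, IsCompact K → K ⊆ {t : ℂ | |t.re| < π/2 ∧ |t.im| < p} →
      TendstoUniformlyOn
        (fun (M : ℕ) (t : ℂ) => ∑ m ∈ Finset.range M, e m * a (I * (μ m : ℂ)) * Ψ m t)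
        (fun t : ℂ => ∑' m : ℕ, e m * a (I * (μ m : ℂ)) * Ψ m t) atTop K) ∧
    DifferentiableOn ℂ (fun t : ℂ => ∑' m : ℕ, e m * a (I * (μ m : ℂ)) * Ψ m t)
      {t : ℂ | |t.re| < π/2 ∧ |t.im| < p} := by
  have key : ∀ K : Set ℂ, IsCompact K → K ⊆ {t : ℂ | |t.re| < π/2 ∧ |t.im| < p} →
      ∃ u : ℕ → ℝ, Summable u ∧
        ∀ m : ℕ, ∀ t ∈ K, ‖e m * a (I * (μ m : ℂ)) * Ψ m t‖ ≤ u m := by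
    intro K hK hKs
    obtain ⟨q, hqp, hq⟩ : ∃ q < p, ∀ t ∈ K, |t.im| ≤ q := by
      rcases K.eq_empty_or_nonempty with h | h
      · exact ⟨p - 1, by linarith, by simp [h]⟩
      · obtain ⟨x, hx, hmax⟩ := hK.exists_isMaxOn h
          (f := fun t : ℂ => |t.im|) (by fun_prop)
        exact ⟨|x.im|, (hKs hx).2, fun t ht => hmax ht⟩
    obtain ⟨B, hB⟩ := hK.exists_bound_of_continuousOn (f := fun t : ℂ => P.eval t)
      P.continuous.continuousOn
    have hμt : Tendsto μ atTop atTop := by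
      refine tendsto_atTop_mono' atTop ?_
        (tendsto_natCast_atTop_atTop.const_mul_atTop hc₀)
      filter_upwards [eventually_ge_atTop M₀] with m hm using hμ m hm
    set R : Polynomial ℝ := (1 + Polynomial.X) ^ N * Q with hR
    obtain ⟨ε, hε⟩ : ∃ ε, ε = (p - q) / 2 := ⟨_, rfl⟩
    have hε0 : 0 < ε := by rw [hε]; linarith
    set S : Polynomial ℝ := R.comp (Polynomial.C ε⁻¹ * Polynomial.X) with hS
    have hlim : ∀ᶠ m : ℕ in atTop, |R.eval (μ m)| ≤ Real.exp (ε * μ m) := by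
      have h1 := (S.tendsto_div_exp_atTop).comp (hμt.const_mul_atTop hε0)
      have h2 := h1.abs.eventually (ge_mem_nhds (by norm_num : |(0:ℝ)| < 1))
      filter_upwards [h2] with m hm
      have h3 : S.eval (ε * μ m) = R.eval (μ m) := by
        simp [hS, Polynomial.eval_comp, hε0.ne']
      simp only [Function.comp, h3, abs_div, Real.abs_exp] at hm
      rwa [div_le_one (Real.exp_pos _)] at hm
    have hsum : Summable (fun m : ℕ => |R.eval (μ m)| * Real.exp (-(p - q) * μ m)) := by
      have hg : Summable (fun m : ℕ => Real.exp (m * (-(ε * c₀)))) :=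
        Real.summable_exp_nat_mul_iff.2 (by have := mul_pos hε0 hc₀; linarith)
      refine Summable.of_norm_bounded_eventually_nat hg ?_
      filter_upwards [hlim, eventually_ge_atTop M₀] with m hm hm2
      rw [Real.norm_of_nonneg (by positivity)]
      calc _ ≤ Real.exp (ε * μ m) * Real.exp (-(p - q) * μ m) := by gcongr
        _ = Real.exp (-(ε * μ m)) := by rw [← Real.exp_add]; congr 1; rw [hε]; ring
        _ ≤ _ := by
          apply Real.exp_le_exp.2
          nlinarith [mul_le_mul_of_nonneg_left (hμ m hm2) hε0.le]
    refine ⟨_, hsum.mul_left (|C₁| * |C| * |C₂| * |B|), ?_⟩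
    intro m t ht
    have hm := hμpos m
    have b1 : ‖e m‖ ≤ |C₁| * (1 + μ m) ^ N :=
      (he m).trans (by gcongr; exact le_abs_self _)
    have b2 : ‖a (I * (μ m : ℂ))‖ ≤ |C| * Real.exp (-p * μ m) := by
      have := haC (I * (μ m : ℂ)) (by simp; linarith)
      simp only [mul_im, mul_re, I_re, I_im, ofReal_re, ofReal_im] at this
      simp only [zero_mul, one_mul, zero_add, mul_zero, sub_zero, abs_zero, add_zero] at this
      exact this.trans (by gcongr; exact le_abs_self _)
    have b3 : ‖Ψ m t‖ ≤ |C₂| * |Q.eval (μ m)| * |B| * Real.exp (q * μ m) := by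
      refine (hΨ m t (hKs ht).1).trans ?_
      gcongr
      · exact le_abs_self _
      · exact (hB t ht).trans (le_abs_self _)
      · exact hq t ht
    rw [norm_mul, norm_mul]
    calc _ ≤ (|C₁| * (1 + μ m) ^ N) * (|C| * Real.exp (-p * μ m)) *
          (|C₂| * |Q.eval (μ m)| * |B| * Real.exp (q * μ m)) := by gcongr
      _ = _ := by
        have hx : Real.exp (-(p - q) * μ m) = Real.exp (-p * μ m) * Real.exp (q * μ m) := by
          rw [← Real.exp_add]; congr 1; ring
        have hr : |R.eval (μ m)| = (1 + μ m) ^ N * |Q.eval (μ m)| := by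
          simp only [hR, Polynomial.eval_mul, Polynomial.eval_pow, Polynomial.eval_add,
            Polynomial.eval_one, Polynomial.eval_X, abs_mul]
          rw [abs_of_nonneg (by positivity)]
        rw [hx, hr]; ring
  have hopen : IsOpen {t : ℂ | |t.re| < π/2 ∧ |t.im| < p} := by
    rw [Set.setOf_and]
    apply IsOpen.inter
    · exact isOpen_lt (by fun_prop) (by fun_prop)
    · exact isOpen_lt (by fun_prop) (by fun_prop)
  have hunif : ∀ K : Set ℂ, IsCompact K → K ⊆ {t : ℂ | |t.re| < π/2 ∧ |t.im| < p} →
      TendstoUniformlyOn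
        (fun (M : ℕ) (t : ℂ) => ∑ m ∈ Finset.range M, e m * a (I * (μ m : ℂ)) * Ψ m t)
        (fun t : ℂ => ∑' m : ℕ, e m * a (I * (μ m : ℂ)) * Ψ m t) atTop K := by
    intro K hK hKs
    obtain ⟨u, hu, hb⟩ := key K hK hKs
    exact tendstoUniformlyOn_tsum_nat hu hb
  refine ⟨?_, hunif, ?_⟩
  · intro t h1 h2
    obtain ⟨u, hu, hb⟩ := key {t} isCompact_singleton (by simpa using ⟨h1, h2⟩)
    exact Summable.of_nonneg_of_le (fun _ => norm_nonneg _) (fun m => hb m t rfl) hu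
  · refine TendstoLocallyUniformlyOn.differentiableOn
      ((tendstoLocallyUniformlyOn_iff_forall_isCompact hopen).2
        fun K hKs hK => hunif K hK hKs) (Eventually.of_forall fun M => ?_) hopen
    refine DifferentiableOn.fun_sum fun m _ => ?_
    exact ((hΨhol m).mono fun t ht => ht.1).const_mul _
end
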